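/- Let m and n be positive integers. The triples in QMP(m,n) all of whose coordinates are rational numbers are dense in QMP(m,n): for every (a,b,c) ∈ QMP(m,n) and every ε > 0 there exists (a',b',c') ∈ QMP(m,n) with all entries of a', b', c' rational and with the distance from (a,b,c) to (a',b',c') less than ε. -/

import Mathlib

open Matrix
open scoped ComplexOrder

noncomputable section

/-- A density operator: positive semidefinite with trace 1. -/
def IsDensityOp {I : Type*} [Fintype I] (ρ : Matrix I I ℂ) : Prop :=
  ρ.PosSemidef ∧ ρ.trace = 1

/-- Partial trace over the second tensor factor. -/
def ptraceB {I J : Type*} [Fintype J] (ρ : Matrix (I × J) (I × J) ℂ) :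
    Matrix I I ℂ :=
  Matrix.of fun i i' => ∑ j, ρ (i, j) (i', j)

/-- Partial trace over the first tensor factor. -/
def ptraceA {I J : Type*} [Fintype I] (ρ : Matrix (I × J) (I × J) ℂ) :
    Matrix J J ℂ :=
  Matrix.of fun j j' => ∑ i, ρ (i, j) (i, j')

/-- `a` is the spectrum of `A`: the vector of eigenvalues of the Hermitian matrix `A`
listed in nonincreasing order (with respect to the ordering of the index type given by
the equivalence `e` with `Fin d`). -/
def IsSpectrum {d : ℕ} {I : Type*} [Fintype I] [DecidableEq I]
    (A : Matrix I I ℂ) (e : I ≃ Fin d) (a : I → ℝ) : Prop :=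
  ∃ hA : A.IsHermitian,
    (∃ σ : Equiv.Perm I, a = hA.eigenvalues ∘ σ) ∧ Antitone (a ∘ e.symm)

/-- The set of admissible spectral triples. -/
def QMP (m n : ℕ) :
    Set ((Fin m → ℝ) × (Fin n → ℝ) × (Fin m × Fin n → ℝ)) :=
  {t | ∃ ρ : Matrix (Fin m × Fin n) (Fin m × Fin n) ℂ,
    IsDensityOp ρ ∧
    IsSpectrum (ptraceB ρ) (Equiv.refl (Fin m)) t.1 ∧
    IsSpectrum (ptraceA ρ) (Equiv.refl (Fin n)) t.2.1 ∧
    IsSpectrum ρ finProdFinEquiv t.2.2}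

section Spectrum

lemma exists_perm_of_map_univ_eq {ι α : Type*} [Fintype ι] {f g : ι → α}
    (h : Finset.univ.val.map f = Finset.univ.val.map g) : ∃ σ : Equiv.Perm ι, f = g ∘ σ := by
  classical
  have key : ∀ y, Nonempty ({x // f x = y} ≃ {x // g x = y}) := by
    intro y
    rw [← Fintype.card_eq, Fintype.card_subtype, Fintype.card_subtype]
    have := congrArg (Multiset.count y) h
    simp only [Multiset.count_map, eq_comm (a := y)] at this
    exact this
  let E := fun y => (key y).some
  exact ⟨Equiv.ofFiberEquiv E, funext fun x => (Equiv.ofFiberEquiv_map E x).symm⟩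

variable {d : ℕ} {I : Type*} [Fintype I] [DecidableEq I]

/-- Conjugation of a real diagonal matrix by `V`. -/
def conjDiag (V : Matrix I I ℂ) (a : I → ℝ) : Matrix I I ℂ :=
  V * diagonal (fun i => (a i : ℂ)) * Vᴴ

lemma conjDiag_isHermitian (V : Matrix I I ℂ) (a : I → ℝ) : (conjDiag V a).IsHermitian := by
  refine isHermitian_mul_mul_conjTranspose _ ?_
  rw [Matrix.IsHermitian, diagonal_conjTranspose]
  congr 1
  ext i
  simp

lemma trace_conjDiag {V : Matrix I I ℂ} (hV : Vᴴ * V = 1) (a : I → ℝ) :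
    (conjDiag V a).trace = ∑ i, (a i : ℂ) := by
  rw [conjDiag, trace_mul_comm, ← mul_assoc, hV, one_mul, trace_diagonal]

lemma roots_charpoly_conjDiag {V : Matrix I I ℂ} (hV : Vᴴ * V = 1) (a : I → ℝ) :
    (conjDiag V a).charpoly.roots = Finset.univ.val.map (fun i => (a i : ℂ)) := by
  rw [conjDiag, charpoly_mul_comm, ← mul_assoc, hV, one_mul, charpoly_diagonal]
  rw [Polynomial.roots_prod _ _ (Finset.prod_ne_zero_iff.2
    fun i _ => Polynomial.X_sub_C_ne_zero _)]
  simp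

lemma IsSpectrum.exists_conjDiag {A : Matrix I I ℂ} {e : I ≃ Fin d} {a : I → ℝ}
    (h : IsSpectrum A e a) : ∃ V ∈ unitaryGroup I ℂ, A = conjDiag V a := by
  obtain ⟨hA, ⟨σ, rfl⟩, -⟩ := h
  let U : Matrix I I ℂ := ↑hA.eigenvectorUnitary
  have hUU : star U * U = 1 := mem_unitaryGroup_iff'.1 hA.eigenvectorUnitary.2
  refine ⟨U.submatrix id σ, ?_, ?_⟩
  · rw [mem_unitaryGroup_iff', star_eq_conjTranspose, conjTranspose_submatrix]
    refine (submatrix_mul_equiv Uᴴ U σ (Equiv.refl I) σ).trans ?_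
    rw [← star_eq_conjTranspose, hUU]
    simp
  · have h1 : diagonal (fun i => (((hA.eigenvalues ∘ σ) i : ℝ) : ℂ)) =
        (diagonal (RCLike.ofReal ∘ hA.eigenvalues : I → ℂ)).submatrix σ σ := by
      rw [submatrix_diagonal_equiv]; rfl
    rw [conjDiag, h1, conjTranspose_submatrix, submatrix_mul_equiv, submatrix_mul_equiv]
    conv_lhs => rw [hA.spectral_theorem, Unitary.conjStarAlgAut_apply]
    rfl

lemma isSpectrum_conjDiag {V : Matrix I I ℂ} (hV : V ∈ unitaryGroup I ℂ) {e : I ≃ Fin d}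
    {a : I → ℝ} (ha : Antitone (a ∘ e.symm)) : IsSpectrum (conjDiag V a) e a := by
  refine ⟨conjDiag_isHermitian V a, ?_, ha⟩
  have h := roots_charpoly_conjDiag (mem_unitaryGroup_iff'.1 hV) a
  rw [(conjDiag_isHermitian V a).roots_charpoly_eq_eigenvalues] at h
  obtain ⟨σ, hσ⟩ := exists_perm_of_map_univ_eq h
  refine ⟨σ.symm, ?_⟩
  ext i
  have := congrFun hσ (σ.symm i)
  simp at this
  simp [this]

lemma exists_isSpectrum {A : Matrix I I ℂ} (hA : A.IsHermitian) (e : I ≃ Fin d) :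
    ∃ a, IsSpectrum A e a := by
  let f : Fin d → ℝ := fun k => - hA.eigenvalues (e.symm k)
  let τ := Tuple.sort f
  refine ⟨hA.eigenvalues ∘ ((e.trans τ).trans e.symm), hA, ⟨_, rfl⟩, ?_⟩
  intro x y hxy
  have := Tuple.monotone_sort f hxy
  simp [f, τ] at this ⊢
  exact this

lemma IsSpectrum.unique {A : Matrix I I ℂ} {e : I ≃ Fin d} {a b : I → ℝ}
    (ha : IsSpectrum A e a) (hb : IsSpectrum A e b) : a = b := by
  obtain ⟨hA, ⟨σ, hσ⟩, h1⟩ := ha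
  obtain ⟨_, ⟨τ, hτ⟩, h2⟩ := hb
  have key := Tuple.unique_antitone (f := hA.eigenvalues ∘ e.symm)
    (σ := (e.symm.trans σ).trans e) (τ := (e.symm.trans τ).trans e)
    (by rw [hσ] at h1; simpa [Function.comp_def] using h1)
    (by rw [hτ] at h2; simpa [Function.comp_def] using h2)
  ext i
  have := congrFun key (e i)
  simpa [hσ, hτ] using this

lemma isCompact_unitaryGroup : IsCompact (unitaryGroup I ℂ : Set (Matrix I I ℂ)) := by
  have hK : IsCompact (Set.univ.pi fun _ : I => Set.univ.pi fun _ : I =>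
      Metric.closedBall (0 : ℂ) 1) :=
    isCompact_univ_pi fun _ => isCompact_univ_pi fun _ => isCompact_closedBall _ _
  refine IsCompact.of_isClosed_subset hK ?_ ?_
  · have : (unitaryGroup I ℂ : Set (Matrix I I ℂ)) = {V | V * star V = 1} := by
      ext V; exact mem_unitaryGroup_iff
    rw [this]
    exact isClosed_eq (by fun_prop) continuous_const
  · intro V hV i _ j _
    simpa using entry_norm_bound_of_unitary hV i j

/-- The ordered spectrum depends continuously on the matrix. -/
lemma IsSpectrum.eventually_dist_lt {A : Matrix I I ℂ} {e : I ≃ Fin d} {a : I → ℝ}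
    (h : IsSpectrum A e a) {ε : ℝ} (hε : 0 < ε) :
    ∀ᶠ B in nhds A, ∀ b, IsSpectrum B e b → dist a b < ε := by
  have : CompactSpace (unitaryGroup I ℂ) := isCompact_iff_compactSpace.1 isCompact_unitaryGroup
  let D : Matrix I I ℂ × unitaryGroup I ℂ → Matrix I I ℂ :=
    fun p => (p.2 : Matrix I I ℂ)ᴴ * p.1 * p.2
  have hD : Continuous D := by fun_prop
  let β : Matrix I I ℂ × unitaryGroup I ℂ → I → ℝ := fun p i => (D p i i).re
  have hβ : Continuous β := by fun_prop
  let S : Set (Matrix I I ℂ × unitaryGroup I ℂ) :=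
    {p | D p = diagonal (fun i => (β p i : ℂ)) ∧ Antitone (β p ∘ e.symm) ∧ ε ≤ dist a (β p)}
  have hS : IsClosed S := by
    have hβD : Continuous fun p => diagonal (fun i => (β p i : ℂ)) :=
      Continuous.matrix_diagonal (by fun_prop)
    refine (isClosed_eq hD hβD).inter (IsClosed.inter ?_ ?_)
    · have : {p | Antitone (β p ∘ e.symm)} =
          ⋂ (x : Fin d) (y : Fin d) (_ : x ≤ y), {p | β p (e.symm y) ≤ β p (e.symm x)} := by
        ext p; simp [Antitone]
      change IsClosed {p | Antitone (β p ∘ e.symm)}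
      rw [this]
      exact isClosed_iInter fun x => isClosed_iInter fun y => isClosed_iInter fun _ =>
        isClosed_le ((continuous_apply _).comp hβ) ((continuous_apply _).comp hβ)
    · exact isClosed_le continuous_const (continuous_const.dist hβ)
  have hcl := isClosedMap_fst_of_compactSpace (X := Matrix I I ℂ) S hS
  have hA : A ∉ Prod.fst '' S := by
    rintro ⟨⟨A', V⟩, ⟨h1, h2, h3⟩, rfl⟩
    have hV := mem_unitaryGroup_iff.1 V.2
    have : A' = conjDiag (V : Matrix I I ℂ) (β (A', V)) := by
      rw [conjDiag, ← h1]
      change A' = V * ((star (V : Matrix I I ℂ)) * A' * V) * (star (V : Matrix I I ℂ))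
      calc A' = (V * star (V : Matrix I I ℂ)) * A' * (V * star (V : Matrix I I ℂ)) := by
            rw [hV]; simp
        _ = _ := by simp only [mul_assoc]
    have h4 := isSpectrum_conjDiag V.2 h2
    rw [← this] at h4
    have := h.unique h4
    rw [← this] at h3
    simp at h3
    linarith
  filter_upwards [hcl.isOpen_compl.mem_nhds hA] with B hB b hb
  by_contra! hlt
  obtain ⟨V, hV, hBV⟩ := hb.exists_conjDiag
  have hVV : Vᴴ * V = 1 := mem_unitaryGroup_iff'.1 hV
  have hDB : D (B, ⟨V, hV⟩) = diagonal (fun i => (b i : ℂ)) := by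
    change Vᴴ * B * V = _
    rw [hBV, conjDiag]
    calc _ = (Vᴴ * V) * diagonal (fun i => (b i : ℂ)) * (Vᴴ * V) := by simp only [mul_assoc]
      _ = _ := by rw [hVV]; simp
  have hβB : β (B, ⟨V, hV⟩) = b := by
    ext i; simp [β, hDB]
  refine hB ⟨(B, ⟨V, hV⟩), ⟨?_, ?_, ?_⟩, rfl⟩
  · rw [hβB, hDB]
  · rw [hβB]; exact hb.2.2
  · rw [hβB]; exact hlt

end Spectrum

section RationalApproximation

variable {d : ℕ} {I : Type*} [Fintype I]

lemma exists_rat_seq [Nonempty I] (e : I ≃ Fin d) {a : I → ℝ} (h0 : 0 ≤ a)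
    (h1 : ∑ i, a i = 1) (ha : Antitone (a ∘ e.symm)) :
    ∃ u : ℕ → I → ℝ, Filter.Tendsto u Filter.atTop (nhds a) ∧
      ∀ N, 0 ≤ u N ∧ ∑ i, u N i = 1 ∧ Antitone (u N ∘ e.symm) ∧ ∀ i, ∃ q : ℚ, u N i = q := by
  let w : ℕ → I → ℚ := fun N i => (⌊a i * N⌋₊ : ℚ) / N
  let r : ℕ → ℚ := fun N => (1 - ∑ i, w N i) / Fintype.card I
  have hcard : (Fintype.card I : ℝ) ≠ 0 := by simp
  have hwle : ∀ N i, ((w N i : ℚ) : ℝ) ≤ a i := by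
    intro N i
    rcases Nat.eq_zero_or_pos N with rfl | hN
    · simpa [w] using h0 i
    · simp only [w, Rat.cast_div, Rat.cast_natCast]
      rw [div_le_iff₀ (by exact_mod_cast hN)]
      exact Nat.floor_le (mul_nonneg (h0 i) (Nat.cast_nonneg N))
  have hw0 : ∀ N i, (0 : ℝ) ≤ w N i := by
    intro N i
    simp only [w, Rat.cast_div, Rat.cast_natCast]
    positivity
  have hr0 : ∀ N, (0 : ℝ) ≤ r N := by
    intro N
    simp only [r, Rat.cast_div, Rat.cast_sub, Rat.cast_one, Rat.cast_sum, Rat.cast_natCast]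
    refine div_nonneg ?_ (Nat.cast_nonneg _)
    have := Finset.sum_le_sum fun i (_ : i ∈ Finset.univ) => hwle N i
    linarith
  have hwt : ∀ i, Filter.Tendsto (fun N => ((w N i : ℚ) : ℝ)) Filter.atTop (nhds (a i)) := by
    intro i
    simp only [w, Rat.cast_div, Rat.cast_natCast]
    exact (tendsto_nat_floor_mul_div_atTop (h0 i)).comp tendsto_natCast_atTop_atTop
  have hrt : Filter.Tendsto (fun N => ((r N : ℚ) : ℝ)) Filter.atTop (nhds 0) := by
    simp only [r, Rat.cast_div, Rat.cast_sub, Rat.cast_one, Rat.cast_sum, Rat.cast_natCast]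
    have := ((tendsto_finsetSum Finset.univ fun i _ => hwt i).const_sub 1).div_const
      (Fintype.card I : ℝ)
    simpa [h1] using this
  refine ⟨fun N i => ((w N i + r N : ℚ) : ℝ), ?_, fun N => ⟨?_, ?_, ?_, fun i => ⟨_, rfl⟩⟩⟩
  · rw [tendsto_pi_nhds]
    intro i
    simpa using (hwt i).add hrt
  · intro i
    simpa using add_nonneg (hw0 N i) (hr0 N)
  · simp only [r, Rat.cast_add, Rat.cast_div, Rat.cast_sub, Rat.cast_one, Rat.cast_sum,
      Rat.cast_natCast, Finset.sum_add_distrib, Finset.sum_const, Finset.card_univ, nsmul_eq_mul]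
    field_simp
    ring
  · intro x y hxy
    have := ha hxy
    simp only [Function.comp_apply, Rat.cast_le, w] at this ⊢
    gcongr

end RationalApproximation

section Perturbation

open scoped Kronecker

lemma eventually_injective_affine {E G : Type*} [AddCommGroup E] [Module ℂ E]
    [FiniteDimensional ℂ E] [AddCommGroup G] [Module ℂ G] (f₀ f₁ : E →ₗ[ℂ] G)
    (h : Function.Injective f₁) :
    ∀ᶠ t : ℝ in nhdsWithin 0 (Set.Ioi 0),
      Function.Injective (((1 - t : ℝ) : ℂ) • f₀ + (t : ℂ) • f₁) := by
  obtain ⟨g, hg⟩ := f₁.exists_leftInverse_of_injective (LinearMap.ker_eq_bot.2 h)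
  let φ : Module.End ℂ E := g ∘ₗ f₀
  have hfin : {μ : ℂ | φ.HasEigenvalue μ}.Finite := Module.End.finite_hasEigenvalue φ
  let q : ℝ → ℂ := fun t => ((-t / (1 - t) : ℝ) : ℂ)
  have hq : Set.InjOn q (Set.Iio 1) := by
    intro s hs t ht hst
    have hs' : (1 - s) ≠ 0 := by simp at hs; linarith
    have ht' : (1 - t) ≠ 0 := by simp at ht; linarith
    simp only [q, Complex.ofReal_inj] at hst
    field_simp at hst
    linarith
  have hS : (Set.Iio 1 ∩ q ⁻¹' {μ : ℂ | φ.HasEigenvalue μ}).Finite := by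
    refine Set.Finite.of_finite_image (f := q) (hfin.subset ?_) (hq.mono Set.inter_subset_left)
    rintro _ ⟨t, ht, rfl⟩
    exact ht.2
  have h1 : ∀ᶠ t : ℝ in nhdsWithin 0 (Set.Ioi 0),
      t ∉ (Set.Iio 1 ∩ q ⁻¹' {μ : ℂ | φ.HasEigenvalue μ}) \ {0} :=
    nhdsWithin_le_nhds ((hS.subset Set.sdiff_subset).isClosed.isOpen_compl.mem_nhds (by simp))
  have h2 : ∀ᶠ t : ℝ in nhdsWithin 0 (Set.Ioi 0), t < 1 :=
    nhdsWithin_le_nhds (Iio_mem_nhds one_pos)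
  filter_upwards [h1, h2, self_mem_nhdsWithin] with t ht ht1 ht0
  rw [← LinearMap.ker_eq_bot, LinearMap.ker_eq_bot']
  intro v hv
  by_contra hne
  refine ht ⟨⟨ht1, ?_⟩, ne_of_gt ht0⟩
  have h3 : ((1 - t : ℝ) : ℂ) • φ v + (t : ℂ) • v = 0 := by
    have := congrArg g hv
    simp only [LinearMap.add_apply, LinearMap.smul_apply, map_add, map_smul, map_zero] at this
    rwa [← LinearMap.comp_apply g f₁, hg] at this
  have ht' : ((1 - t : ℝ) : ℂ) ≠ 0 := by
    rw [Complex.ofReal_ne_zero]; linarith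
  refine Module.End.hasEigenvalue_of_hasEigenvector (x := v) ⟨?_, hne⟩
  rw [Module.End.mem_eigenspace_iff]
  have h4 : φ v = ((1 - t : ℝ) : ℂ)⁻¹ • (-((t : ℂ) • v)) := by
    rw [← eq_neg_of_add_eq_zero_left h3, smul_smul, inv_mul_cancel₀ ht', one_smul]
  rw [h4, smul_neg, smul_smul, ← neg_smul]
  congr 1
  simp only [q]
  push_cast
  ring

variable {I J : Type*} [Fintype I] [Fintype J] [DecidableEq I] [DecidableEq J]

/-- The local operator `X ⊗ 1 + 1 ⊗ Y`. -/
def localOp (X : Matrix I I ℂ) (Y : Matrix J J ℂ) : Matrix (I × J) (I × J) ℂ :=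
  X ⊗ₖ 1 + 1 ⊗ₖ Y

/-- No nonzero pair of traceless matrices gives a local operator commuting with `ρ`. -/
def LocallyRigid (ρ : Matrix (I × J) (I × J) ℂ) : Prop :=
  ∀ (X : Matrix I I ℂ) (Y : Matrix J J ℂ), localOp X Y * ρ = ρ * localOp X Y →
    X.trace = 0 → Y.trace = 0 → X = 0 ∧ Y = 0

/-- The linear map whose injectivity expresses `LocallyRigid`. -/
def rigidityMap (ρ : Matrix (I × J) (I × J) ℂ) :
    Matrix I I ℂ × Matrix J J ℂ →ₗ[ℂ] Matrix (I × J) (I × J) ℂ × ℂ × ℂ where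
  toFun x := (localOp x.1 x.2 * ρ - ρ * localOp x.1 x.2, x.1.trace, x.2.trace)
  map_add' x y := by
    simp only [localOp, Prod.fst_add, Prod.snd_add, trace_add, add_kronecker, kronecker_add,
      Prod.mk_add_mk, Prod.mk.injEq, and_true, add_mul, mul_add]
    abel
  map_smul' r x := by
    simp [localOp, smul_kronecker, kronecker_smul, smul_sub, mul_add, add_mul]

lemma locallyRigid_iff {ρ : Matrix (I × J) (I × J) ℂ} :
    LocallyRigid ρ ↔ Function.Injective (rigidityMap ρ) := by
  rw [← LinearMap.ker_eq_bot, LinearMap.ker_eq_bot']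
  simp [LocallyRigid, rigidityMap, sub_eq_zero]

lemma LocallyRigid.eventually {ρ σ : Matrix (I × J) (I × J) ℂ} (hσ : LocallyRigid σ) :
    ∀ᶠ t : ℝ in nhdsWithin 0 (Set.Ioi 0),
      LocallyRigid (((1 - t : ℝ) : ℂ) • ρ + (t : ℂ) • σ) := by
  filter_upwards [eventually_injective_affine (rigidityMap ρ) _ (locallyRigid_iff.1 hσ)] with t ht
  rw [locallyRigid_iff]
  have key : rigidityMap (((1 - t : ℝ) : ℂ) • ρ + (t : ℂ) • σ) =
      ((1 - t : ℝ) : ℂ) • rigidityMap ρ + (t : ℂ) • rigidityMap σ := by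
    refine LinearMap.ext fun x => Prod.ext ?_ (Prod.ext ?_ ?_)
    · simp only [rigidityMap, LinearMap.coe_mk, AddHom.coe_mk, LinearMap.add_apply,
        LinearMap.smul_apply, Prod.smul_mk, Prod.mk_add_mk, mul_add, add_mul, mul_smul_comm,
        smul_mul_assoc, smul_sub]
      abel
    · simp [rigidityMap, sub_mul]
    · simp [rigidityMap, sub_mul]
  rw [key]
  exact ht

lemma LocallyRigid.smul_add {σ : Matrix (I × J) (I × J) ℂ} (hσ : LocallyRigid σ) {r : ℂ}
    (hr : r ≠ 0) (s : ℂ) : LocallyRigid (r • (σ + s • 1)) := by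
  intro X Y h
  refine hσ X Y ?_
  rw [mul_smul_comm, smul_mul_assoc] at h
  have := smul_right_injective _ hr h
  simpa [mul_add, add_mul] using this

lemma localOp_mul_apply (X : Matrix I I ℂ) (Y : Matrix J J ℂ) (ρ : Matrix (I × J) (I × J) ℂ)
    (i : I) (j : J) (q : I × J) :
    (localOp X Y * ρ) (i, j) q = ∑ k, X i k * ρ (k, j) q + ∑ l, Y j l * ρ (i, l) q := by
  simp only [localOp, add_mul, mul_apply, Fintype.sum_prod_type, one_apply, kroneckerMap_apply,
    Matrix.add_apply, Finset.sum_add_distrib]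
  congr 1
  · simp
  · rw [Finset.sum_comm]
    simp

lemma mul_localOp_apply (X : Matrix I I ℂ) (Y : Matrix J J ℂ) (ρ : Matrix (I × J) (I × J) ℂ)
    (p : I × J) (i : I) (j : J) :
    (ρ * localOp X Y) p (i, j) = ∑ k, ρ p (k, j) * X k i + ∑ l, ρ p (i, l) * Y l j := by
  simp only [localOp, mul_add, mul_apply, Fintype.sum_prod_type, one_apply, kroneckerMap_apply,
    Matrix.add_apply, Finset.sum_add_distrib]
  congr 1
  · simp
  · rw [Finset.sum_comm]
    simp

end Perturbation

section Rigid

variable {m n : ℕ}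

/-- A Hermitian matrix which is locally rigid when both factors have dimension at least two. -/
def rigidMatrix (m n : ℕ) : Matrix (Fin m × Fin n) (Fin m × Fin n) ℂ :=
  diagonal (fun p => ((p.1 : ℂ) + 1) * ((p.2 : ℂ) + 1)) +
    of fun p q => if p.1 ≠ q.1 ∧ p.2 ≠ q.2 then 1 else 0

lemma rigidMatrix_isHermitian : (rigidMatrix m n).IsHermitian := by
  ext p q
  by_cases hpq : p = q
  · subst hpq
    simp [rigidMatrix]
  · simp [rigidMatrix, hpq, Ne.symm hpq, eq_comm, apply_ite]

lemma rigidMatrix_apply (i i' : Fin m) (j j' : Fin n) :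
    rigidMatrix m n (i, j) (i', j') =
      if i = i' then (if j = j' then ((i : ℂ) + 1) * ((j : ℂ) + 1) else 0)
      else if j = j' then 0 else 1 := by
  by_cases hi : i = i' <;> by_cases hj : j = j' <;> simp [rigidMatrix, hi, hj]

lemma sum_natCast_add_one_ne_zero (hn : 0 < n) : ∑ j : Fin n, ((j : ℂ) + 1) ≠ 0 := by
  have : (∑ j : Fin n, ((j : ℂ) + 1)) = ((∑ j : Fin n, ((j : ℕ) + 1) : ℕ) : ℂ) := by
    push_cast; rfl
  rw [this, Nat.cast_ne_zero]
  have : Nonempty (Fin n) := ⟨⟨0, hn⟩⟩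
  exact (Finset.sum_pos (fun j _ => Nat.succ_pos _) Finset.univ_nonempty).ne'

lemma rigidMatrix_locallyRigid (hm : 2 ≤ m) (hn : 2 ≤ n) : LocallyRigid (rigidMatrix m n) := by
  intro X Y h hX hY
  have hentry : ∀ i j i' j', (localOp X Y * rigidMatrix m n) (i, j) (i', j') =
      (rigidMatrix m n * localOp X Y) (i, j) (i', j') := fun i j i' j' => by rw [h]
  simp only [localOp_mul_apply, mul_localOp_apply, rigidMatrix_apply] at hentry
  have hXoff : ∀ i i', i ≠ i' → X i i' = 0 := by
    intro i i' hne
    have key : ∀ j : Fin n, X i i' * ((i' : ℂ) - i) * ((j : ℂ) + 1) +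
        (∑ l, Y j l - ∑ l, Y l j) = 0 := by
      intro j
      have := hentry i j i' j
      simp [hne, Finset.sum_ite, Finset.filter_ne, Finset.filter_ne'] at this
      linear_combination this
    have hsum := Finset.sum_eq_zero fun j (_ : j ∈ Finset.univ) => key j
    rw [Finset.sum_add_distrib, ← Finset.mul_sum, Finset.sum_sub_distrib,
      Finset.sum_comm (f := fun j l => Y l j), sub_self, add_zero] at hsum
    have hii : ((i' : ℂ) - i) ≠ 0 := by
      rw [sub_ne_zero, Ne, Nat.cast_inj, ← Fin.ext_iff]
      exact hne.symm
    simpa [hii, sum_natCast_add_one_ne_zero (show 0 < n by omega)] using hsum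
  have hYoff : ∀ j j', j ≠ j' → Y j j' = 0 := by
    intro j j' hne
    have key : ∀ i : Fin m, Y j j' * ((j' : ℂ) - j) * ((i : ℂ) + 1) +
        (∑ l, X i l - ∑ l, X l i) = 0 := by
      intro i
      have := hentry i j i j'
      simp [hne, Finset.sum_ite, Finset.filter_ne, Finset.filter_ne'] at this
      linear_combination this
    have hsum := Finset.sum_eq_zero fun j (_ : j ∈ Finset.univ) => key j
    rw [Finset.sum_add_distrib, ← Finset.mul_sum, Finset.sum_sub_distrib,
      Finset.sum_comm (f := fun j l => X l j), sub_self, add_zero] at hsum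
    have hii : ((j' : ℂ) - j) ≠ 0 := by
      rw [sub_ne_zero, Ne, Nat.cast_inj, ← Fin.ext_iff]
      exact hne.symm
    simpa [hii, sum_natCast_add_one_ne_zero (show 0 < m by omega)] using hsum
  have hdiag : ∀ i i' j j', i ≠ i' → j ≠ j' → X i i + Y j j = X i' i' + Y j' j' := by
    intro i i' j j' hi hj
    have := hentry i j i' j'
    rw [Fintype.sum_eq_single i fun k hk => by simp [hXoff i k hk.symm],
      Fintype.sum_eq_single j fun k hk => by simp [hYoff j k hk.symm],
      Fintype.sum_eq_single i' fun k hk => by simp [hXoff k i' hk],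
      Fintype.sum_eq_single j' fun k hk => by simp [hYoff k j' hk]] at this
    simpa [hi, hj] using this
  let j₀ : Fin n := ⟨0, by omega⟩
  let j₁ : Fin n := ⟨1, by omega⟩
  have hj : j₀ ≠ j₁ := by simp [j₀, j₁]
  let i₀ : Fin m := ⟨0, by omega⟩
  let i₁ : Fin m := ⟨1, by omega⟩
  have hi : i₀ ≠ i₁ := by simp [i₀, i₁]
  have hXc : ∀ i i', X i i = X i' i' := by
    intro i i'
    by_cases h : i = i'
    · rw [h]
    · linear_combination (hdiag i i' j₀ j₁ h hj + hdiag i i' j₁ j₀ h hj.symm) / 2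
  have hYc : ∀ j j', Y j j = Y j' j' := by
    intro j j'
    by_cases h : j = j'
    · rw [h]
    · linear_combination (hdiag i₀ i₁ j j' hi h + hdiag i₁ i₀ j j' hi.symm h) / 2
  constructor
  · ext i i'
    by_cases h : i = i'
    · subst h
      have hm0 : (m : ℂ) ≠ 0 := by simp; omega
      simpa [trace, fun k => hXc k i, hm0] using hX
    · exact hXoff i i' h
  · ext j j'
    by_cases h : j = j'
    · subst h
      have hn0 : (n : ℂ) ≠ 0 := by simp; omega
      simpa [trace, fun k => hYc k j, hn0] using hY
    · exact hYoff j j' h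

end Rigid

section ImplicitFunction

lemma eventually_exists_eq_zero {E F P : Type*} [NormedAddCommGroup E] [NormedSpace ℝ E]
    [NormedAddCommGroup F] [NormedSpace ℝ F] [NormedAddCommGroup P] [NormedSpace ℝ P]
    [CompleteSpace E] [CompleteSpace F] [CompleteSpace P] {Ψ : E × P → F} {Ψ' : E × P →L[ℝ] F}
    {x₀ : E} {p₀ : P} (h : HasStrictFDerivAt Ψ Ψ' (x₀, p₀)) (h0 : Ψ (x₀, p₀) = 0)
    (hsurj : Function.Surjective fun x => Ψ' (x, 0)) :
    ∀ᶠ p in nhds p₀, ∃ x, Ψ (x, p) = 0 := by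
  have hG : HasStrictFDerivAt (fun z : E × P => (Ψ z, z.2))
      (Ψ'.prod (ContinuousLinearMap.snd ℝ E P)) (x₀, p₀) :=
    h.prodMk hasStrictFDerivAt_snd
  have hr : (Ψ'.prod (ContinuousLinearMap.snd ℝ E P)).range = ⊤ := by
    rw [LinearMap.range_eq_top]
    rintro ⟨y, p⟩
    obtain ⟨x, hx⟩ := hsurj (y - Ψ' (0, p))
    refine ⟨(x, p), ?_⟩
    have : ((x, p) : E × P) = (x, 0) + (0, p) := by simp
    simp only [ContinuousLinearMap.coe_coe, ContinuousLinearMap.prod_apply,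
      ContinuousLinearMap.coe_snd', Prod.mk.injEq, and_true]
    rw [this, map_add]
    simp only at hx
    rw [hx]
    abel
  have hmap := hG.map_nhds_eq_of_surj hr
  have hrange : Set.range (fun z : E × P => (Ψ z, z.2)) ∈ nhds (0, p₀) := by
    rw [← h0, ← hmap]
    exact Filter.mem_map.2 (Filter.univ_mem' fun z => Set.mem_range_self z)
  have hc : Filter.Tendsto (fun p : P => ((0, p) : F × P)) (nhds p₀) (nhds (0, p₀)) :=
    (Continuous.prodMk_right (0 : F)).tendsto p₀
  filter_upwards [hc hrange] with p hp
  obtain ⟨⟨x, p'⟩, hz⟩ := hp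
  simp only [Prod.mk.injEq] at hz
  obtain ⟨hz, rfl⟩ := hz
  exact ⟨x, hz⟩

open NormedSpace in
lemma eventually_exists_exp_conj {𝔸 F P : Type*} [NormedRing 𝔸] [NormedAlgebra ℝ 𝔸]
    [CompleteSpace 𝔸] [NormedAddCommGroup F] [NormedSpace ℝ F] [FiniteDimensional ℝ F]
    [NormedAddCommGroup P] [NormedSpace ℝ P] [CompleteSpace P]
    (k : F →L[ℝ] 𝔸) (C : P →L[ℝ] 𝔸) (T : 𝔸 →L[ℝ] F) (D : P →L[ℝ] F) (S : F →L[ℝ] F) {p₀ : P}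
    (h0 : T (C p₀) = D p₀)
    (hinj : ∀ x, T (k x * C p₀ - C p₀ * k x) + S x = 0 → x = 0) :
    ∀ᶠ p in nhds p₀, ∃ x, T (exp (k x) * C p * exp (-k x)) + S x = D p := by
  have : CompleteSpace F := FiniteDimensional.complete ℝ F
  have hk : HasStrictFDerivAt (fun z : F × P => exp (k z.1))
      (k ∘L ContinuousLinearMap.fst ℝ F P) (0, p₀) := by
    have he : HasStrictFDerivAt (exp : 𝔸 → 𝔸) (1 : 𝔸 →L[ℝ] 𝔸) (k ((0 : F), p₀).1) := by
      simpa using hasStrictFDerivAt_exp_zero (𝕂 := ℝ) (𝔸 := 𝔸)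
    exact he.comp (0, p₀) (k ∘L ContinuousLinearMap.fst ℝ F P).hasStrictFDerivAt
  have hk' : HasStrictFDerivAt (fun z : F × P => exp (-k z.1))
      (-(k ∘L ContinuousLinearMap.fst ℝ F P)) (0, p₀) := by
    have he : HasStrictFDerivAt (exp : 𝔸 → 𝔸) (1 : 𝔸 →L[ℝ] 𝔸) (-k ((0 : F), p₀).1) := by
      simpa using hasStrictFDerivAt_exp_zero (𝕂 := ℝ) (𝔸 := 𝔸)
    exact he.comp (0, p₀) (k ∘L ContinuousLinearMap.fst ℝ F P).hasStrictFDerivAt.neg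
  have hC := (C ∘L ContinuousLinearMap.snd ℝ F P).hasStrictFDerivAt (x := ((0 : F), p₀))
  have hmul := (hk.mul' hC).mul' hk'
  have hΨ := ((T.hasStrictFDerivAt.comp (0, p₀) hmul).add
    (S ∘L ContinuousLinearMap.fst ℝ F P).hasStrictFDerivAt).sub
    (D ∘L ContinuousLinearMap.snd ℝ F P).hasStrictFDerivAt
  have hev := eventually_exists_eq_zero hΨ (by simp [h0]) ?_
  · filter_upwards [hev] with p hp
    obtain ⟨x, hx⟩ := hp
    exact ⟨x, sub_eq_zero.1 hx⟩
  · let f : F →ₗ[ℝ] F :=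
      { toFun := fun x => T (k x * C p₀ - C p₀ * k x) + S x
        map_add' := fun x y => by simp only [map_add, map_sub, add_mul, mul_add]; abel
        map_smul' := fun r x => by simp [smul_sub] }
    have hf : Function.Injective f := by
      rw [← LinearMap.ker_eq_bot, LinearMap.ker_eq_bot']
      exact hinj
    convert (LinearMap.injective_iff_surjective.1 hf) using 1
    ext x
    simp [f]
    abel

end ImplicitFunction

section PartialTrace

variable {I J : Type*}

@[simp]
lemma trace_ptraceB [Fintype I] [Fintype J] (ρ : Matrix (I × J) (I × J) ℂ) :
    (ptraceB ρ).trace = ρ.trace := by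
  simp [trace, ptraceB, Fintype.sum_prod_type]

@[simp]
lemma trace_ptraceA [Fintype I] [Fintype J] (ρ : Matrix (I × J) (I × J) ℂ) :
    (ptraceA ρ).trace = ρ.trace := by
  simp [trace, ptraceA, Fintype.sum_prod_type_right]

lemma ptraceB_isHermitian [Fintype J] {ρ : Matrix (I × J) (I × J) ℂ} (h : ρ.IsHermitian) :
    (ptraceB ρ).IsHermitian := by
  ext i i'
  simp [ptraceB, h.apply]

lemma ptraceA_isHermitian [Fintype I] {ρ : Matrix (I × J) (I × J) ℂ} (h : ρ.IsHermitian) :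
    (ptraceA ρ).IsHermitian := by
  ext i i'
  simp [ptraceA, h.apply]

lemma ptraceB_posSemidef [Fintype J] {ρ : Matrix (I × J) (I × J) ℂ} (h : ρ.PosSemidef) :
    (ptraceB ρ).PosSemidef := by
  have : ptraceB ρ = ∑ j, ρ.submatrix (fun i => (i, j)) (fun i => (i, j)) := by
    ext i i'
    simp [ptraceB, Matrix.sum_apply]
  rw [this]
  exact posSemidef_sum _ fun j _ => h.submatrix _

lemma ptraceA_posSemidef [Fintype I] {ρ : Matrix (I × J) (I × J) ℂ} (h : ρ.PosSemidef) :
    (ptraceA ρ).PosSemidef := by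
  have : ptraceA ρ = ∑ i, ρ.submatrix (fun j => (i, j)) (fun j => (i, j)) := by
    ext j j'
    simp [ptraceA, Matrix.sum_apply]
  rw [this]
  exact posSemidef_sum _ fun j _ => h.submatrix _

lemma trace_localOp_mul [Fintype I] [Fintype J] [DecidableEq I] [DecidableEq J]
    (X : Matrix I I ℂ) (Y : Matrix J J ℂ) (M : Matrix (I × J) (I × J) ℂ) :
    (localOp X Y * M).trace = (X * ptraceB M).trace + (Y * ptraceA M).trace := by
  simp only [trace, diag_apply, Fintype.sum_prod_type, localOp_mul_apply, Finset.sum_add_distrib]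
  simp only [mul_apply, ptraceA, ptraceB, of_apply, Finset.mul_sum]
  congr 1
  · exact Finset.sum_congr rfl fun i _ => Finset.sum_comm
  · rw [Finset.sum_comm]
    exact Finset.sum_congr rfl fun i _ => Finset.sum_comm

lemma localOp_isHermitian [DecidableEq I] [DecidableEq J]
    {X : Matrix I I ℂ} {Y : Matrix J J ℂ} (hX : X.IsHermitian)
    (hY : Y.IsHermitian) : (localOp X Y).IsHermitian := by
  rw [Matrix.IsHermitian, localOp, conjTranspose_add, conjTranspose_kronecker,
    conjTranspose_kronecker, hX.eq, hY.eq]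
  simp

end PartialTrace

section Slack

variable {I : Type*} [Fintype I] [DecidableEq I]

/-- A real linear map whose values meet the traceless Hermitian matrices only at zero. -/
def slack : Matrix I I ℂ →ₗ[ℝ] Matrix I I ℂ where
  toFun X := (X - Xᴴ) + (X + Xᴴ).trace • 1
  map_add' X Y := by
    simp only [conjTranspose_add, trace_add, add_smul]
    abel
  map_smul' r X := by
    simp only [conjTranspose_smul, trace_add, trace_smul, star_trivial, RingHom.id_apply,
      smul_add, smul_sub, add_smul, smul_assoc]

lemma slack_eq_zero [Nonempty I] {X A B : Matrix I I ℂ} (hA : A.IsHermitian) (hB : B.IsHermitian)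
    (htr : A.trace = B.trace) (h : A + slack X = B) :
    X = Xᴴ ∧ (X + Xᴴ).trace = 0 ∧ A = B := by
  have hs : slack X = (X - Xᴴ) + (X + Xᴴ).trace • 1 := rfl
  have hreal : star (X + Xᴴ).trace = (X + Xᴴ).trace := by
    rw [← trace_conjTranspose, conjTranspose_add, conjTranspose_conjTranspose, add_comm]
  have hstar : (slack X)ᴴ = slack X := by
    rw [eq_sub_of_add_eq' h, conjTranspose_sub, hA.eq, hB.eq]
  have hX : X = Xᴴ := by
    rw [hs, conjTranspose_add, conjTranspose_sub, conjTranspose_smul, hreal,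
      conjTranspose_conjTranspose, conjTranspose_one, add_left_inj] at hstar
    have h2 : (2 : ℂ) • (X - Xᴴ) = 0 := by
      rw [two_smul]
      nth_rewrite 1 [← hstar]
      abel
    exact sub_eq_zero.1 ((smul_eq_zero.1 h2).resolve_left two_ne_zero)
  have h0 : (X + Xᴴ).trace = 0 := by
    have h3 := congrArg trace h
    have hcard : (Fintype.card I : ℂ) ≠ 0 := by simp
    rw [hs, sub_eq_zero.2 hX, zero_add, trace_add, htr, trace_smul, trace_one, smul_eq_mul,
      add_eq_left] at h3
    exact (mul_eq_zero.1 h3).resolve_right hcard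
  refine ⟨hX, h0, ?_⟩
  rw [hs, h0, sub_eq_zero.2 hX] at h
  simpa using h

end Slack

section ConjDiag

variable {I : Type*} [Fintype I] [DecidableEq I]

/-- `conjDiag V` as a real linear map. -/
def conjDiagLinear (V : Matrix I I ℂ) : (I → ℝ) →ₗ[ℝ] Matrix I I ℂ where
  toFun := conjDiag V
  map_add' a b := by
    simp only [conjDiag, ← add_mul, ← mul_add, diagonal_add, Pi.add_apply, Complex.ofReal_add]
  map_smul' r a := by
    simp only [conjDiag, RingHom.id_apply, Pi.smul_apply, smul_eq_mul, Complex.ofReal_mul]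
    rw [← smul_mul_assoc, ← mul_smul_comm, ← diagonal_smul]
    rfl

lemma conjDiag_posSemidef (V : Matrix I I ℂ) {a : I → ℝ} (ha : 0 ≤ a) :
    (conjDiag V a).PosSemidef := by
  refine PosSemidef.mul_mul_conjTranspose_same (PosSemidef.diagonal fun i => ?_) V
  simpa using ha i

lemma conjDiag_isDensityOp {V : Matrix I I ℂ} (hV : V ∈ unitaryGroup I ℂ) {a : I → ℝ}
    (ha : 0 ≤ a) (h1 : ∑ i, a i = 1) : IsDensityOp (conjDiag V a) := by
  refine ⟨conjDiag_posSemidef V ha, ?_⟩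
  rw [trace_conjDiag (mem_unitaryGroup_iff'.1 hV), ← Complex.ofReal_sum, h1, Complex.ofReal_one]

lemma conjDiag_mul_left (U V : Matrix I I ℂ) (a : I → ℝ) :
    conjDiag (U * V) a = U * conjDiag V a * Uᴴ := by
  simp only [conjDiag, conjTranspose_mul, mul_assoc]

lemma IsSpectrum.sum_eq_trace {d : ℕ} {A : Matrix I I ℂ} {e : I ≃ Fin d} {a : I → ℝ}
    (h : IsSpectrum A e a) : ((∑ i, a i : ℝ) : ℂ) = A.trace := by
  obtain ⟨V, hV, rfl⟩ := h.exists_conjDiag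
  rw [trace_conjDiag (mem_unitaryGroup_iff'.1 hV), Complex.ofReal_sum]

lemma IsSpectrum.nonneg {d : ℕ} {A : Matrix I I ℂ} {e : I ≃ Fin d} {a : I → ℝ}
    (h : IsSpectrum A e a) (hA : A.PosSemidef) : 0 ≤ a := by
  obtain ⟨_, ⟨σ, rfl⟩, -⟩ := h
  exact fun i => hA.eigenvalues_nonneg _

end ConjDiag

section RigidOpen

variable {I J : Type*} [Fintype I] [Fintype J] [DecidableEq I] [DecidableEq J]

/-- The skew-Hermitian commutator of `ρ` with the local operator of the Hermitian parts. -/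
def commutatorMap (ρ : Matrix (I × J) (I × J) ℂ) :
    Matrix I I ℂ × Matrix J J ℂ →ₗ[ℝ] Matrix (I × J) (I × J) ℂ where
  toFun x := ρ * localOp (x.1 + x.1ᴴ) (x.2 + x.2ᴴ) - localOp (x.1 + x.1ᴴ) (x.2 + x.2ᴴ) * ρ
  map_add' x y := by
    simp only [localOp, Prod.fst_add, Prod.snd_add, conjTranspose_add, add_kronecker,
      kronecker_add, add_mul, mul_add]
    abel
  map_smul' r x := by
    simp only [localOp, Prod.smul_fst, Prod.smul_snd, conjTranspose_smul, star_trivial,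
      ← smul_add, smul_kronecker, kronecker_smul, mul_smul_comm, smul_mul_assoc, ← smul_sub,
      RingHom.id_apply]

lemma commutatorMap_conjTranspose {ρ : Matrix (I × J) (I × J) ℂ} (hρ : ρ.IsHermitian)
    (x : Matrix I I ℂ × Matrix J J ℂ) : (commutatorMap ρ x)ᴴ = -commutatorMap ρ x := by
  have h := localOp_isHermitian (isHermitian_add_transpose_self x.1)
    (isHermitian_add_transpose_self x.2)
  change (ρ * localOp (x.1 + x.1ᴴ) (x.2 + x.2ᴴ) - localOp (x.1 + x.1ᴴ) (x.2 + x.2ᴴ) * ρ)ᴴ =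
    -(ρ * localOp (x.1 + x.1ᴴ) (x.2 + x.2ᴴ) - localOp (x.1 + x.1ᴴ) (x.2 + x.2ᴴ) * ρ)
  rw [conjTranspose_sub, conjTranspose_mul, conjTranspose_mul, h.eq, hρ.eq, neg_sub]

/-- The pair of partial traces as a real linear map. -/
def marginals : Matrix (I × J) (I × J) ℂ →ₗ[ℝ] Matrix I I ℂ × Matrix J J ℂ where
  toFun M := (ptraceB M, ptraceA M)
  map_add' M N := by
    ext <;> simp [ptraceA, ptraceB, Finset.sum_add_distrib]
  map_smul' r M := by
    ext <;> simp [ptraceA, ptraceB, Finset.mul_sum]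

lemma LocallyRigid.eq_zero_of_marginals [Nonempty I] [Nonempty J]
    {ρ : Matrix (I × J) (I × J) ℂ} (hr : LocallyRigid ρ) (hρ : ρ.IsHermitian)
    (x : Matrix I I ℂ × Matrix J J ℂ)
    (h : marginals (commutatorMap ρ x * ρ - ρ * commutatorMap ρ x) +
      (slack x.1, slack x.2) = 0) : x = 0 := by
  set K := commutatorMap ρ x with hK
  set H := localOp (x.1 + x.1ᴴ) (x.2 + x.2ᴴ) with hH
  have hKH : K = ρ * H - H * ρ := rfl
  have hKs : Kᴴ = -K := commutatorMap_conjTranspose hρ x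
  have hM : (K * ρ - ρ * K).IsHermitian := by
    rw [Matrix.IsHermitian, conjTranspose_sub, conjTranspose_mul, conjTranspose_mul, hKs, hρ.eq]
    simp only [mul_neg, neg_mul]
    abel
  have htr : (K * ρ - ρ * K).trace = 0 := by
    rw [trace_sub, trace_mul_comm, sub_self]
  obtain ⟨hX, hX0, hB⟩ := slack_eq_zero (ptraceB_isHermitian hM) isHermitian_zero
    (by rw [trace_ptraceB, htr, trace_zero]) (congrArg Prod.fst h)
  obtain ⟨hY, hY0, hA⟩ := slack_eq_zero (ptraceA_isHermitian hM) isHermitian_zero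
    (by rw [trace_ptraceA, htr, trace_zero]) (congrArg Prod.snd h)
  have h1 : (H * (K * ρ - ρ * K)).trace = 0 := by
    rw [hH, trace_localOp_mul, hA, hB]
    simp
  have h2 : (Kᴴ * K).trace = 0 := by
    rw [hKs, neg_mul, trace_neg, neg_eq_zero, ← h1]
    nth_rewrite 1 [hKH]
    rw [sub_mul, mul_sub, trace_sub, trace_sub, mul_assoc, trace_mul_comm ρ]
    simp only [mul_assoc]
  have hK0 : K = 0 := trace_conjTranspose_mul_self_eq_zero_iff.1 h2
  obtain ⟨h3, h4⟩ := hr _ _ (sub_eq_zero.1 (hKH ▸ hK0)).symm hX0 hY0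
  rw [← hX, ← two_smul ℂ] at h3
  rw [← hY, ← two_smul ℂ] at h4
  exact Prod.ext ((smul_eq_zero.1 h3).resolve_left two_ne_zero)
    ((smul_eq_zero.1 h4).resolve_left two_ne_zero)

open scoped Matrix.Norms.Operator in
/-- Near a locally rigid state every triple of normalized vectors is realized as the spectra of
some state and its marginals. -/
lemma LocallyRigid.eventually_exists_conjDiag [Nonempty I] [Nonempty J]
    {a : I → ℝ} {b : J → ℝ} {c : I × J → ℝ}
    {V : Matrix I I ℂ} {V' : Matrix J J ℂ} {W : Matrix (I × J) (I × J) ℂ}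
    (hV : V ∈ unitaryGroup I ℂ) (hV' : V' ∈ unitaryGroup J ℂ) (hW : W ∈ unitaryGroup (I × J) ℂ)
    (hr : LocallyRigid (conjDiag W c)) (ha : ptraceB (conjDiag W c) = conjDiag V a)
    (hb : ptraceA (conjDiag W c) = conjDiag V' b) :
    ∀ᶠ p : (I → ℝ) × (J → ℝ) × (I × J → ℝ) in nhds (a, b, c),
      ∑ i, p.1 i = 1 → ∑ j, p.2.1 j = 1 → ∑ q, p.2.2 q = 1 →
      ∃ U ∈ unitaryGroup (I × J) ℂ, ptraceB (conjDiag U p.2.2) = conjDiag V p.1 ∧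
        ptraceA (conjDiag U p.2.2) = conjDiag V' p.2.1 := by
  let P := (I → ℝ) × (J → ℝ) × (I × J → ℝ)
  let C : P →ₗ[ℝ] Matrix (I × J) (I × J) ℂ :=
    conjDiagLinear W ∘ₗ LinearMap.snd ℝ _ _ ∘ₗ LinearMap.snd ℝ _ _
  let D : P →ₗ[ℝ] Matrix I I ℂ × Matrix J J ℂ :=
    (conjDiagLinear V).prodMap (conjDiagLinear V' ∘ₗ LinearMap.fst ℝ _ _)
  let S : Matrix I I ℂ × Matrix J J ℂ →ₗ[ℝ] Matrix I I ℂ × Matrix J J ℂ := slack.prodMap slack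
  have key := eventually_exists_exp_conj (p₀ := (a, b, c))
    (commutatorMap (conjDiag W c)).toContinuousLinearMap
    C.toContinuousLinearMap (marginals (I := I) (J := J)).toContinuousLinearMap
    D.toContinuousLinearMap S.toContinuousLinearMap (Prod.ext ha hb)
    (hr.eq_zero_of_marginals (conjDiag_isHermitian W c))
  filter_upwards [key] with p hp h1 h2 h3
  obtain ⟨x, hx⟩ := hp
  change marginals (NormedSpace.exp (commutatorMap (conjDiag W c) x) * C p *
    NormedSpace.exp (-commutatorMap (conjDiag W c) x)) + S x = D p at hx
  set K := commutatorMap (conjDiag W c) x with hK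
  have hKs : Kᴴ = -K := commutatorMap_conjTranspose (conjDiag_isHermitian W c) x
  have hstar : (NormedSpace.exp K)ᴴ = NormedSpace.exp (-K) := by
    rw [← exp_conjTranspose, hKs]
  have hU : NormedSpace.exp K * W ∈ unitaryGroup (I × J) ℂ := by
    refine mul_mem ?_ hW
    rw [mem_unitaryGroup_iff, star_eq_conjTranspose, hstar,
      ← exp_add_of_commute _ _ (Commute.refl K).neg_right, add_neg_cancel, NormedSpace.exp_zero]
  have hM : NormedSpace.exp K * C p * NormedSpace.exp (-K) =
      conjDiag (NormedSpace.exp K * W) p.2.2 := by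
    rw [conjDiag_mul_left, hstar]
    rfl
  rw [hM] at hx
  have htr := trace_conjDiag (mem_unitaryGroup_iff'.1 hU) p.2.2
  rw [← Complex.ofReal_sum, h3] at htr
  refine ⟨_, hU, ?_, ?_⟩
  · refine (slack_eq_zero (ptraceB_isHermitian (conjDiag_isHermitian _ _))
      (conjDiag_isHermitian V p.1) ?_ (congrArg Prod.fst hx)).2.2
    rw [trace_ptraceB, htr, trace_conjDiag (mem_unitaryGroup_iff'.1 hV), ← Complex.ofReal_sum, h1]
  · refine (slack_eq_zero (ptraceA_isHermitian (conjDiag_isHermitian _ _))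
      (conjDiag_isHermitian V' p.2.1) ?_ (congrArg Prod.snd hx)).2.2
    rw [trace_ptraceA, htr, trace_conjDiag (mem_unitaryGroup_iff'.1 hV'), ← Complex.ofReal_sum,
      h2]

end RigidOpen

section Density

lemma exists_locallyRigid_isDensityOp {m n : ℕ} (hm : 2 ≤ m) (hn : 2 ≤ n) :
    ∃ σ : Matrix (Fin m × Fin n) (Fin m × Fin n) ℂ, IsDensityOp σ ∧ LocallyRigid σ := by
  have : Nonempty (Fin m × Fin n) := ⟨⟨⟨0, by omega⟩, ⟨0, by omega⟩⟩⟩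
  obtain ⟨l, hl⟩ := exists_isSpectrum (rigidMatrix_isHermitian (m := m) (n := n)) finProdFinEquiv
  obtain ⟨V, hV, hVl⟩ := hl.exists_conjDiag
  set K : ℝ := ∑ p, |l p| + 1 with hK
  have hpos : ∀ p, 0 < l p + K := by
    intro p
    have h1 := Finset.single_le_sum (f := fun p => |l p|) (fun p _ => abs_nonneg (l p))
      (Finset.mem_univ p)
    have h2 := neg_abs_le (l p)
    linarith
  set τ : ℝ := ∑ p, (l p + K) with hτ
  have hτ0 : 0 < τ := Finset.sum_pos (fun p _ => hpos p) Finset.univ_nonempty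
  refine ⟨((τ⁻¹ : ℝ) : ℂ) • (rigidMatrix m n + (K : ℂ) • 1), ?_,
    (rigidMatrix_locallyRigid hm hn).smul_add
      (Complex.ofReal_ne_zero.2 (inv_ne_zero hτ0.ne')) _⟩
  have hKV : conjDiagLinear V (fun _ => K) = (K : ℂ) • 1 := by
    change V * diagonal (fun _ => (K : ℂ)) * Vᴴ = _
    rw [← smul_one_eq_diagonal, mul_smul_comm, smul_mul_assoc, mul_one,
      ← star_eq_conjTranspose, mem_unitaryGroup_iff.1 hV]
  have h : ((τ⁻¹ : ℝ) : ℂ) • (rigidMatrix m n + (K : ℂ) • 1) =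
      conjDiag V (τ⁻¹ • (l + fun _ => K)) := by
    change _ = conjDiagLinear V (τ⁻¹ • (l + fun _ => K))
    rw [map_smul, map_add, hKV, hVl]
    rfl
  rw [h]
  refine conjDiag_isDensityOp hV (fun p => ?_) ?_
  · exact mul_nonneg (inv_nonneg.2 hτ0.le) (hpos p).le
  · simp only [Pi.smul_apply, Pi.add_apply, smul_eq_mul, ← Finset.mul_sum]
    exact inv_mul_cancel₀ hτ0.ne'

lemma IsSpectrum.sum_eq_one {d : ℕ} {I : Type*} [Fintype I] [DecidableEq I] {A : Matrix I I ℂ}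
    {e : I ≃ Fin d} {a : I → ℝ} (h : IsSpectrum A e a) (hA : A.trace = 1) : ∑ i, a i = 1 := by
  have := h.sum_eq_trace
  rw [hA] at this
  exact_mod_cast this

/-- The rational spectral triples accumulate at `t`. -/
def QMPRationalNear {m n : ℕ} (t : (Fin m → ℝ) × (Fin n → ℝ) × (Fin m × Fin n → ℝ)) : Prop :=
  ∀ ε > 0, ∃ (a' : Fin m → ℝ) (b' : Fin n → ℝ) (c' : Fin m × Fin n → ℝ),
    (a', b', c') ∈ QMP m n ∧ (∀ i, ∃ q : ℚ, a' i = (q : ℝ)) ∧ (∀ j, ∃ q : ℚ, b' j = (q : ℝ)) ∧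
      (∀ p, ∃ q : ℚ, c' p = (q : ℝ)) ∧ dist t (a', b', c') < ε

lemma LocallyRigid.qmpRationalNear {m n : ℕ} [NeZero m] [NeZero n]
    {ρ : Matrix (Fin m × Fin n) (Fin m × Fin n) ℂ} (hr : LocallyRigid ρ) (hρ : IsDensityOp ρ)
    {a : Fin m → ℝ} {b : Fin n → ℝ} {c : Fin m × Fin n → ℝ}
    (ha : IsSpectrum (ptraceB ρ) (Equiv.refl (Fin m)) a)
    (hb : IsSpectrum (ptraceA ρ) (Equiv.refl (Fin n)) b)
    (hc : IsSpectrum ρ finProdFinEquiv c) : QMPRationalNear (a, b, c) := by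
  intro ε hε
  obtain ⟨u, hu, hu'⟩ := exists_rat_seq _ (ha.nonneg (ptraceB_posSemidef hρ.1))
    (IsSpectrum.sum_eq_one ha ((trace_ptraceB ρ).trans hρ.2)) ha.2.2
  obtain ⟨v, hv, hv'⟩ := exists_rat_seq _ (hb.nonneg (ptraceA_posSemidef hρ.1))
    (IsSpectrum.sum_eq_one hb ((trace_ptraceA ρ).trans hρ.2)) hb.2.2
  obtain ⟨w, hw, hw'⟩ := exists_rat_seq _ (hc.nonneg hρ.1)
    (IsSpectrum.sum_eq_one hc hρ.2) hc.2.2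
  obtain ⟨V, hV, hVa⟩ := ha.exists_conjDiag
  obtain ⟨V', hV', hVb⟩ := hb.exists_conjDiag
  obtain ⟨W, hW, rfl⟩ := hc.exists_conjDiag
  have hlim := hu.prodMk_nhds (hv.prodMk_nhds hw)
  obtain ⟨N, hN, hd⟩ := ((hlim.eventually
    (hr.eventually_exists_conjDiag hV hV' hW hVa hVb)).and
      (hlim.eventually (Metric.ball_mem_nhds _ hε))).exists
  obtain ⟨-, hu1, hu2, hu3⟩ := hu' N
  obtain ⟨-, hv1, hv2, hv3⟩ := hv' N
  obtain ⟨hw0, hw1, hw2, hw3⟩ := hw' N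
  obtain ⟨U, hU, hUa, hUb⟩ := hN hu1 hv1 hw1
  refine ⟨u N, v N, w N, ⟨conjDiag U (w N), conjDiag_isDensityOp hU hw0 hw1, ?_, ?_,
    isSpectrum_conjDiag hU hw2⟩, hu3, hv3, hw3, by rwa [dist_comm]⟩
  · exact hUa ▸ isSpectrum_conjDiag hV hu2
  · exact hUb ▸ isSpectrum_conjDiag hV' hv2

lemma qmpRationalNear_of_two_le {m n : ℕ} (hm : 2 ≤ m) (hn : 2 ≤ n)
    {t : (Fin m → ℝ) × (Fin n → ℝ) × (Fin m × Fin n → ℝ)} (h : t ∈ QMP m n) :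
    QMPRationalNear t := by
  have : NeZero m := ⟨by omega⟩
  have : NeZero n := ⟨by omega⟩
  obtain ⟨ρ, hρ, ha, hb, hc⟩ := h
  intro ε hε
  obtain ⟨σ, hσ, hr⟩ := exists_locallyRigid_isDensityOp hm hn
  let R : ℝ → Matrix (Fin m × Fin n) (Fin m × Fin n) ℂ :=
    fun s => ((1 - s : ℝ) : ℂ) • ρ + (s : ℂ) • σ
  have hR : Continuous R := by fun_prop
  have hRB : Continuous fun s => ptraceB (R s) := by
    refine continuous_matrix fun i i' => ?_
    simp only [ptraceB, of_apply]
    exact continuous_finsetSum _ fun j _ => hR.matrix_elem _ _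
  have hRA : Continuous fun s => ptraceA (R s) := by
    refine continuous_matrix fun i i' => ?_
    simp only [ptraceA, of_apply]
    exact continuous_finsetSum _ fun j _ => hR.matrix_elem _ _
  have hR0 : R 0 = ρ := by simp [R]
  rw [← hR0] at ha hb hc
  have hε2 := half_pos hε
  have hlt : ∀ᶠ s : ℝ in nhdsWithin 0 (Set.Ioi 0), s < 1 :=
    nhdsWithin_le_nhds (Iio_mem_nhds one_pos)
  have hBd := (hRB.continuousAt.eventually (ha.eventually_dist_lt hε2)).filter_mono
    (nhdsWithin_le_nhds (s := Set.Ioi 0))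
  have hAd := (hRA.continuousAt.eventually (hb.eventually_dist_lt hε2)).filter_mono
    (nhdsWithin_le_nhds (s := Set.Ioi 0))
  have hRd := (hR.continuousAt.eventually (hc.eventually_dist_lt hε2)).filter_mono
    (nhdsWithin_le_nhds (s := Set.Ioi 0))
  obtain ⟨s, hrs, hs0, hs1, hsa, hsb, hsc⟩ := ((hr.eventually (ρ := ρ)).and
    (eventually_mem_nhdsWithin.and (hlt.and (hBd.and (hAd.and hRd))))).exists
  have hs0' : 0 ≤ s := le_of_lt hs0
  have hs1' : 0 ≤ 1 - s := sub_nonneg.2 (le_of_lt hs1)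
  have hRs : IsDensityOp (R s) := by
    refine ⟨(hρ.1.smul (by exact_mod_cast hs1')).add (hσ.1.smul (by exact_mod_cast hs0')), ?_⟩
    simp [R, hρ.2, hσ.2]
  obtain ⟨a, ha1⟩ := exists_isSpectrum (ptraceB_isHermitian hRs.1.1) (Equiv.refl (Fin m))
  obtain ⟨b, hb1⟩ := exists_isSpectrum (ptraceA_isHermitian hRs.1.1) (Equiv.refl (Fin n))
  obtain ⟨c, hc1⟩ := exists_isSpectrum hRs.1.1 finProdFinEquiv
  obtain ⟨a', b', c', hQ, hqa, hqb, hqc, hd⟩ :=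
    LocallyRigid.qmpRationalNear hrs hRs ha1 hb1 hc1 _ hε2
  refine ⟨a', b', c', hQ, hqa, hqb, hqc, ?_⟩
  have hd1 : dist t (a, b, c) < ε / 2 :=
    max_lt (hsa a ha1) (max_lt (hsb b hb1) (hsc c hc1))
  linarith [dist_triangle t (a, b, c) (a', b', c')]

end Density

section TrivialFactor

lemma eq_one_of_sum_eq_one {I : Type*} [Fintype I] [Unique I] {a : I → ℝ}
    (h : ∑ i, a i = 1) : a = fun _ => 1 := by
  funext i
  rw [Fintype.sum_unique] at h
  rw [Unique.eq_default i, h]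

variable {I J : Type*} [Fintype I] [DecidableEq I] [Fintype J] [DecidableEq J]

lemma ptraceB_conjDiag_one (c : I × J → ℝ) :
    ptraceB (conjDiag 1 c) = conjDiag 1 fun i => ∑ j, c (i, j) := by
  ext i i'
  by_cases h : i = i' <;> simp [ptraceB, conjDiag, h]

lemma ptraceA_conjDiag_one (c : I × J → ℝ) :
    ptraceA (conjDiag 1 c) = conjDiag 1 fun j => ∑ i, c (i, j) := by
  ext j j'
  by_cases h : j = j' <;> simp [ptraceA, conjDiag, h]

lemma IsSpectrum.submatrix {d d' : ℕ} {A : Matrix I I ℂ} {e : I ≃ Fin d} {a : I → ℝ}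
    (h : IsSpectrum A e a) (f : J ≃ I) {e' : J ≃ Fin d'} (ha : Antitone ((a ∘ f) ∘ e'.symm)) :
    IsSpectrum (A.submatrix f f) e' (a ∘ f) := by
  obtain ⟨V, hV, rfl⟩ := h.exists_conjDiag
  have hVf : V.submatrix f f ∈ unitaryGroup J ℂ := by
    rw [mem_unitaryGroup_iff, star_eq_conjTranspose, conjTranspose_submatrix,
      submatrix_mul_equiv, ← star_eq_conjTranspose, mem_unitaryGroup_iff.1 hV,
      submatrix_one_equiv]
  convert isSpectrum_conjDiag hVf ha
  have hD : diagonal (fun j => (((a ∘ f) j : ℝ) : ℂ)) =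
      (diagonal fun i => (a i : ℂ)).submatrix f f := by
    rw [submatrix_diagonal_equiv]
    rfl
  rw [conjDiag, conjDiag, hD, conjTranspose_submatrix, submatrix_mul_equiv, submatrix_mul_equiv]

lemma qmpRationalNear_one_left {n : ℕ} [NeZero n]
    {t : (Fin 1 → ℝ) × (Fin n → ℝ) × (Fin 1 × Fin n → ℝ)} (h : t ∈ QMP 1 n) :
    QMPRationalNear t := by
  obtain ⟨ρ, hρ, ha, hb, hc⟩ := h
  obtain ⟨a, b, c⟩ := t
  dsimp only at ha hb hc
  have hmono : Monotone fun k => (finProdFinEquiv (m := 1) (n := n).symm k).2 := by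
    intro k l hkl
    have hk : (k : ℕ) < n := by simpa using k.2
    have hl : (l : ℕ) < n := by simpa using l.2
    change (k : ℕ) % n ≤ (l : ℕ) % n
    rwa [Nat.mod_eq_of_lt hk, Nat.mod_eq_of_lt hl]
  have hanti : ∀ b : Fin n → ℝ, Antitone (b ∘ (Equiv.refl (Fin n)).symm) →
      Antitone ((b ∘ Equiv.uniqueProd (Fin n) (Fin 1)) ∘ finProdFinEquiv.symm) :=
    fun b hb => Antitone.comp_monotone (g := b) hb hmono
  have hρA : ρ = (ptraceA ρ).submatrix (Equiv.uniqueProd (Fin n) (Fin 1))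
      (Equiv.uniqueProd (Fin n) (Fin 1)) := by
    ext ⟨i, j⟩ ⟨i', j'⟩
    simp [ptraceA, Subsingleton.elim i 0, Subsingleton.elim i' 0]
  have hcb : c = b ∘ Equiv.uniqueProd (Fin n) (Fin 1) := by
    rw [hρA] at hc
    exact hc.unique (hb.submatrix _ (hanti b hb.2.2))
  obtain rfl := eq_one_of_sum_eq_one
    (IsSpectrum.sum_eq_one ha ((trace_ptraceB ρ).trans hρ.2))
  obtain ⟨v, hv, hv'⟩ := exists_rat_seq _ (hb.nonneg (ptraceA_posSemidef hρ.1))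
    (IsSpectrum.sum_eq_one hb ((trace_ptraceA ρ).trans hρ.2)) hb.2.2
  intro ε hε
  have hF : Continuous fun b : Fin n → ℝ =>
      ((fun _ => 1 : Fin 1 → ℝ), b, b ∘ Equiv.uniqueProd (Fin n) (Fin 1)) := by fun_prop
  obtain ⟨N, hN⟩ := (((hF.tendsto b).comp hv).eventually (Metric.ball_mem_nhds _ hε)).exists
  obtain ⟨hv0, hv1, hv2, hv3⟩ := hv' N
  have hsum : ∑ p, (v N ∘ Equiv.uniqueProd (Fin n) (Fin 1)) p = 1 := by
    simp [Fintype.sum_prod_type, hv1]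
  refine ⟨fun _ => 1, v N, v N ∘ Equiv.uniqueProd (Fin n) (Fin 1),
    ⟨conjDiag 1 (v N ∘ Equiv.uniqueProd (Fin n) (Fin 1)),
      conjDiag_isDensityOp (one_mem _) (fun p => hv0 _) hsum, ?_, ?_,
      isSpectrum_conjDiag (one_mem _) (hanti _ hv2)⟩,
    fun _ => ⟨1, by simp⟩, hv3, fun p => hv3 _, ?_⟩
  · rw [ptraceB_conjDiag_one]
    have h1 : (fun i : Fin 1 => ∑ j, (v N ∘ Equiv.uniqueProd (Fin n) (Fin 1)) (i, j)) =
        fun _ => 1 := by simp [hv1]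
    rw [h1]
    exact isSpectrum_conjDiag (one_mem _) antitone_const
  · rw [ptraceA_conjDiag_one]
    convert isSpectrum_conjDiag (one_mem _) hv2
    simp
  · rw [hcb, dist_comm]
    exact hN

lemma qmpRationalNear_one_right {m : ℕ} [NeZero m]
    {t : (Fin m → ℝ) × (Fin 1 → ℝ) × (Fin m × Fin 1 → ℝ)} (h : t ∈ QMP m 1) :
    QMPRationalNear t := by
  obtain ⟨ρ, hρ, ha, hb, hc⟩ := h
  obtain ⟨a, b, c⟩ := t
  dsimp only at ha hb hc
  have hmono : Monotone fun k => (finProdFinEquiv (m := m) (n := 1).symm k).1 := by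
    intro k l hkl
    change (k : ℕ) / 1 ≤ (l : ℕ) / 1
    rwa [Nat.div_one, Nat.div_one]
  have hanti : ∀ a : Fin m → ℝ, Antitone (a ∘ (Equiv.refl (Fin m)).symm) →
      Antitone ((a ∘ Equiv.prodUnique (Fin m) (Fin 1)) ∘ finProdFinEquiv.symm) :=
    fun a ha => Antitone.comp_monotone (g := a) ha hmono
  have hρB : ρ = (ptraceB ρ).submatrix (Equiv.prodUnique (Fin m) (Fin 1))
      (Equiv.prodUnique (Fin m) (Fin 1)) := by
    ext ⟨i, j⟩ ⟨i', j'⟩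
    simp [ptraceB, Subsingleton.elim j 0, Subsingleton.elim j' 0]
  have hca : c = a ∘ Equiv.prodUnique (Fin m) (Fin 1) := by
    rw [hρB] at hc
    exact hc.unique (ha.submatrix _ (hanti a ha.2.2))
  obtain rfl := eq_one_of_sum_eq_one
    (IsSpectrum.sum_eq_one hb ((trace_ptraceA ρ).trans hρ.2))
  obtain ⟨u, hu, hu'⟩ := exists_rat_seq _ (ha.nonneg (ptraceB_posSemidef hρ.1))
    (IsSpectrum.sum_eq_one ha ((trace_ptraceB ρ).trans hρ.2)) ha.2.2
  intro ε hε
  have hF : Continuous fun a : Fin m → ℝ =>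
      (a, (fun _ => 1 : Fin 1 → ℝ), a ∘ Equiv.prodUnique (Fin m) (Fin 1)) := by fun_prop
  obtain ⟨N, hN⟩ := (((hF.tendsto a).comp hu).eventually (Metric.ball_mem_nhds _ hε)).exists
  obtain ⟨hu0, hu1, hu2, hu3⟩ := hu' N
  have hsum : ∑ p, (u N ∘ Equiv.prodUnique (Fin m) (Fin 1)) p = 1 := by
    simp [Fintype.sum_prod_type, hu1]
  refine ⟨u N, fun _ => 1, u N ∘ Equiv.prodUnique (Fin m) (Fin 1),
    ⟨conjDiag 1 (u N ∘ Equiv.prodUnique (Fin m) (Fin 1)),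
      conjDiag_isDensityOp (one_mem _) (fun p => hu0 _) hsum, ?_, ?_,
      isSpectrum_conjDiag (one_mem _) (hanti _ hu2)⟩,
    hu3, fun _ => ⟨1, by simp⟩, fun p => hu3 _, ?_⟩
  · rw [ptraceB_conjDiag_one]
    convert isSpectrum_conjDiag (one_mem _) hu2
    simp
  · rw [ptraceA_conjDiag_one]
    have h1 : (fun j : Fin 1 => ∑ i, (u N ∘ Equiv.prodUnique (Fin m) (Fin 1)) (i, j)) =
        fun _ => 1 := by simp [hu1]
    rw [h1]
    exact isSpectrum_conjDiag (one_mem _) antitone_const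
  · rw [hca, dist_comm]
    exact hN

end TrivialFactor

/-- Rational spectral triples are dense in the set of admissible spectral triples. -/
theorem qmp_rational_dense (m n : ℕ) (hm : 0 < m) (hn : 0 < n)
    (a : Fin m → ℝ) (b : Fin n → ℝ) (c : Fin m × Fin n → ℝ)
    (h : (a, b, c) ∈ QMP m n) (ε : ℝ) (hε : 0 < ε) :
    ∃ (a' : Fin m → ℝ) (b' : Fin n → ℝ) (c' : Fin m × Fin n → ℝ),
      (a', b', c') ∈ QMP m n ∧
      (∀ i, ∃ q : ℚ, a' i = (q : ℝ)) ∧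
      (∀ j, ∃ q : ℚ, b' j = (q : ℝ)) ∧
      (∀ p, ∃ q : ℚ, c' p = (q : ℝ)) ∧
      dist ((a, b, c) : (Fin m → ℝ) × (Fin n → ℝ) × (Fin m × Fin n → ℝ)) (a', b', c') < ε := by
  have : NeZero m := ⟨hm.ne'⟩
  have : NeZero n := ⟨hn.ne'⟩
  rcases Nat.lt_or_ge m 2 with h1 | h1
  · obtain rfl : m = 1 := by omega
    exact qmpRationalNear_one_left h ε hε
  rcases Nat.lt_or_ge n 2 with h2 | h2
  · obtain rfl : n = 1 := by omega
    exact qmpRationalNear_one_right h ε hε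
  exact qmpRationalNear_of_two_le h1 h2 h ε hε
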